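/- For every N ≥ 2 there exist analytic maps Φ₁, Φ₂: D^N → D^N with Φ₁(D^N) = Φ₂(D^N) such that C_{Φ₁} is bounded but not compact on H²(D^N) (so that β_N(C_{Φ₁}) = 1), while C_{Φ₂} is compact on H²(D^N) with β_N(C_{Φ₂}) = 0. -/

import Mathlib

open Complex MeasureTheory Set Filter
open scoped ENNReal Topology

noncomputable section

/-- The open unit disk in `ℂ`. -/
def unitDisk : Set ℂ := Metric.ball (0 : ℂ) 1

/-- A symbol: a non-constant analytic self-map of the unit disk. -/
structure IsSymbol (φ : ℂ → ℂ) : Prop where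
  mapsTo : Set.MapsTo φ unitDisk unitDisk
  diff : DifferentiableOn ℂ φ unitDisk
  nonconst : ¬ ∃ c : ℂ, Set.EqOn φ (fun _ => c) unitDisk

/-- `φ` is `p`-valent: every `w ∈ 𝔻` has at most `p` preimages in `𝔻`. -/
def Valent (φ : ℂ → ℂ) (p : ℕ) : Prop :=
  ∀ w ∈ unitDisk, (unitDisk ∩ φ ⁻¹' {w}).encard ≤ p

/-- The radial limit of `φ` at the boundary point `toCircle θ` exists and equals `w`.
The circle `𝕋` is parametrized by `AddCircle 1` (so that `volume` is the normalized
Haar measure `m`). -/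
def HasRadialLimit (φ : ℂ → ℂ) (θ : AddCircle (1 : ℝ)) (w : ℂ) : Prop :=
  Filter.Tendsto (fun r : ℝ => φ (r * (AddCircle.toCircle θ : ℂ)))
    (nhdsWithin 1 (Set.Iio 1)) (nhds w)

/-- The pull-back measure `m_φ(S) = m({ξ : φ*(ξ) ∈ S})`. -/
def pullbackMeasure (φ : ℂ → ℂ) (S : Set ℂ) : ℝ≥0∞ :=
  volume {θ : AddCircle (1 : ℝ) | ∃ w ∈ S, HasRadialLimit φ θ w}

/-- `ρ_φ(h) = sup_{ξ ∈ 𝕋} m_φ[S(ξ,h)]`, where `S(ξ,h) = {z : |z - ξ| ≤ h}`. -/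
def rho (φ : ℂ → ℂ) (h : ℝ) : ℝ≥0∞ :=
  ⨆ ξ : Circle, pullbackMeasure φ {z : ℂ | ‖z - (ξ : ℂ)‖ ≤ h}

/-- The `n`-th approximation number of a bounded operator between normed spaces:
the distance of `T` to operators of rank `< n`. -/
def approxNum {E F : Type*} [NormedAddCommGroup E] [NormedAddCommGroup F]
    [NormedSpace ℂ E] [NormedSpace ℂ F] (n : ℕ) (T : E →L[ℂ] F) : ℝ :=
  sInf {c : ℝ | ∃ R : E →L[ℂ] F,
    Module.rank ℂ (LinearMap.range (R : E →ₗ[ℂ] F)) < (n : Cardinal) ∧ c = ‖T - R‖}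

/-- The Hardy space `H²(𝔻)` in its coefficient model `ℓ²(ℕ)`. -/
abbrev H2 := lp (fun _ : ℕ => ℂ) 2

/-- The analytic function on `𝔻` associated with an element of `H²`. -/
def H2.eval (a : H2) (z : ℂ) : ℂ := ∑' n : ℕ, a n * z ^ n

/-- `T` is the composition operator with symbol `φ` on `H²(𝔻)`. -/
def IsCompOp (φ : ℂ → ℂ) (T : H2 →L[ℂ] H2) : Prop :=
  ∀ a : H2, ∀ z ∈ unitDisk, H2.eval (T a) z = H2.eval a (φ z)

/-- The open unit polydisk `𝔻^N`. -/
def polyDisk (N : ℕ) : Set (Fin N → ℂ) := {z | ∀ i, ‖z i‖ < 1}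

/-- The Hardy space `H²(𝔻^N)` in its coefficient model `ℓ²(ℕ^N)`. -/
abbrev H2poly (N : ℕ) := lp (fun _ : Fin N → ℕ => ℂ) 2

/-- The analytic function on `𝔻^N` associated with an element of `H²(𝔻^N)`. -/
def H2poly.eval {N : ℕ} (a : H2poly N) (z : Fin N → ℂ) : ℂ :=
  ∑' α : Fin N → ℕ, a α * ∏ i, z i ^ α i

/-- `T` is the composition operator with symbol `Φ` on `H²(𝔻^N)`. -/
def IsCompOpPoly {N : ℕ} (Φ : (Fin N → ℂ) → (Fin N → ℂ))
    (T : H2poly N →L[ℂ] H2poly N) : Prop :=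
  ∀ a : H2poly N, ∀ z ∈ polyDisk N, H2poly.eval (T a) z = H2poly.eval a (Φ z)

/-- The lens map `λ_θ`. -/
def lens (θ : ℝ) (z : ℂ) : ℂ :=
  ((1 + z) ^ (θ : ℂ) - (1 - z) ^ (θ : ℂ)) / ((1 + z) ^ (θ : ℂ) + (1 - z) ^ (θ : ℂ))

theorem fourierCoeffOn_circleMap_eq (f : ℂ → ℂ) {r : ℝ} (hr : 0 < r) (k : ℕ) :
    fourierCoeffOn Real.two_pi_pos (fun θ : ℝ ↦ f (circleMap 0 r θ)) k =
      (cauchyPowerSeries f 0 r).coeff k * r ^ k := by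
  have hr0 : (r : ℂ) ≠ 0 := by exact_mod_cast hr.ne'
  have hπ : (Real.pi : ℂ) ≠ 0 := by exact_mod_cast Real.pi_ne_zero
  have hpt (θ : ℝ) : fourier (-(k : ℤ)) (θ : AddCircle (2 * Real.pi - 0)) • f (circleMap 0 r θ) =
      (r ^ k * I⁻¹) * (deriv (circleMap 0 r) θ • ((circleMap 0 r θ - 0)⁻¹ ^ k •
        (circleMap 0 r θ - 0)⁻¹ • f (circleMap 0 r θ))) := by
    have he : fourier (-(k : ℤ)) (θ : AddCircle (2 * Real.pi - 0)) = (exp (θ * I))⁻¹ ^ k := by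
      rw [fourier_coe_apply, ← Complex.exp_neg, ← Complex.exp_nat_mul]
      congr 1
      push_cast
      field_simp
      ring
    have hexp := Complex.exp_ne_zero (θ * I)
    rw [he, deriv_circleMap]
    simp only [circleMap, smul_eq_mul, zero_add, sub_zero, inv_pow, mul_inv, mul_pow]
    field_simp
  rw [fourierCoeffOn_eq_integral]
  simp_rw [hpt]
  rw [intervalIntegral.integral_const_mul]
  simp only [FormalMultilinearSeries.coeff, cauchyPowerSeries, circleIntegral,
    ContinuousMultilinearMap.mkPiRing_apply, smul_eq_mul, Pi.one_apply, Finset.prod_const_one,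
    one_mul, real_smul]
  push_cast
  field_simp
  simp

theorem sum_sq_coeff_mul_pow_le {f h : ℂ → ℂ} (hf : DifferentiableOn ℂ f (Metric.ball 0 1))
    (hh : DifferentiableOn ℂ h (Metric.ball 0 1))
    (hfh : ∀ z ∈ Metric.ball (0 : ℂ) 1, ‖f z‖ ^ 2 ≤ (h z).re) {r : ℝ} (hr : 0 < r) (hr1 : r < 1)
    (s : Finset ℕ) :
    ∑ k ∈ s, (‖(cauchyPowerSeries f 0 r).coeff k‖ * r ^ k) ^ 2 ≤ (h 0).re := by
  have hsub : Metric.closedBall (0 : ℂ) r ⊆ Metric.ball 0 1 := Metric.closedBall_subset_ball hr1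
  have hmem (θ : ℝ) : circleMap 0 r θ ∈ Metric.ball (0 : ℂ) 1 :=
    hsub (circleMap_mem_closedBall 0 hr.le θ)
  have hcont {g : ℂ → ℂ} (hg : DifferentiableOn ℂ g (Metric.ball 0 1)) :
      Continuous fun θ : ℝ ↦ g (circleMap 0 r θ) :=
    hg.continuousOn.comp_continuous (continuous_circleMap 0 r) hmem
  have hπ : (0 : ℝ) < 2 * Real.pi := Real.two_pi_pos
  have hL2 : MemLp (fun θ : ℝ ↦ f (circleMap 0 r θ)) 2
      (volume.restrict (Ioc 0 (2 * Real.pi))) := by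
    obtain ⟨C, hC⟩ := (isCompact_Icc (a := (0 : ℝ)) (b := 2 * Real.pi)).exists_bound_of_continuousOn
      (hcont hf).continuousOn
    refine MemLp.of_bound (hcont hf).aestronglyMeasurable C ?_
    filter_upwards [ae_restrict_mem measurableSet_Ioc] with θ hθ
    exact hC θ (Ioc_subset_Icc_self hθ)
  have hmean : Real.circleAverage h 0 r = h 0 := by
    refine DiffContOnCl.circleAverage (DifferentiableOn.diffContOnCl (hh.mono ?_))
    rw [abs_of_pos hr]
    exact Metric.closure_ball_subset_closedBall.trans hsub
  calc ∑ k ∈ s, (‖(cauchyPowerSeries f 0 r).coeff k‖ * r ^ k) ^ 2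
      = ∑ k ∈ s.map Nat.castEmbedding,
          ‖fourierCoeffOn hπ (fun θ : ℝ ↦ f (circleMap 0 r θ)) k‖ ^ 2 := by
        simp [fourierCoeffOn_circleMap_eq f hr, abs_of_pos hr]
    _ ≤ (2 * Real.pi - 0)⁻¹ • ∫ θ in 0..2 * Real.pi, ‖f (circleMap 0 r θ)‖ ^ 2 :=
        sum_le_hasSum _ (fun _ _ ↦ by positivity) (hasSum_sq_fourierCoeffOn hπ hL2)
    _ ≤ (2 * Real.pi)⁻¹ • ∫ θ in 0..2 * Real.pi, (h (circleMap 0 r θ)).re := by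
        rw [sub_zero]
        gcongr
        refine intervalIntegral.integral_mono_on hπ.le ?_ ?_ fun θ _ ↦ hfh _ (hmem θ)
        · exact ((hcont hf).norm.pow 2).intervalIntegrable _ _
        · exact (Complex.continuous_re.comp (hcont hh)).intervalIntegrable _ _
    _ = (h 0).re := by
        rw [← hmean, Real.circleAverage_def, Complex.smul_re]
        congr 1
        exact Complex.reCLM.intervalIntegral_comp_comm ((hcont hh).intervalIntegrable _ _)

/-- The Taylor coefficients at `0` of a holomorphic function on the unit disk whose squared modulus
is dominated by the real part of a holomorphic function `h` are square summable, with sum at most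
`(h 0).re`. -/
theorem exists_hasSum_and_sum_sq_le {f h : ℂ → ℂ} (hf : DifferentiableOn ℂ f (Metric.ball 0 1))
    (hh : DifferentiableOn ℂ h (Metric.ball 0 1))
    (hfh : ∀ z ∈ Metric.ball (0 : ℂ) 1, ‖f z‖ ^ 2 ≤ (h z).re) :
    ∃ c : ℕ → ℂ, (∀ z ∈ Metric.ball (0 : ℂ) 1, HasSum (fun k ↦ c k * z ^ k) (f z)) ∧
      ∀ s : Finset ℕ, ∑ k ∈ s, ‖c k‖ ^ 2 ≤ (h 0).re := by
  have hps {r : ℝ} (hr : 0 < r) (hr1 : r < 1) :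
      HasFPowerSeriesOnBall f (cauchyPowerSeries f 0 r) 0 (ENNReal.ofReal r) := by
    lift r to NNReal using hr.le
    rw [ENNReal.ofReal_coe_nnreal]
    exact (hf.mono (Metric.closedBall_subset_ball hr1)).hasFPowerSeriesOnBall (by exact_mod_cast hr)
  have heq {r : ℝ} (hr : 0 < r) (hr1 : r < 1) :
      cauchyPowerSeries f 0 r = cauchyPowerSeries f 0 (1 / 2) :=
    (hps hr hr1).hasFPowerSeriesAt.eq_formalMultilinearSeries
      (hps (by norm_num) (by norm_num)).hasFPowerSeriesAt
  refine ⟨(cauchyPowerSeries f 0 (1 / 2)).coeff, fun z hz ↦ ?_, fun s ↦ ?_⟩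
  · rw [mem_ball_zero_iff] at hz
    obtain ⟨r, hzr, hr1⟩ := exists_between hz
    have hr := (norm_nonneg z).trans_lt hzr
    have := (hps hr hr1).hasSum (y := z) (by
      rw [Metric.mem_eball, edist_zero_right, ← ofReal_norm]
      exact (ENNReal.ofReal_lt_ofReal_iff hr).2 hzr)
    simpa [heq hr hr1, mul_comm] using this
  · have hlim : Tendsto (fun r : ℝ ↦ ∑ k ∈ s,
        (‖(cauchyPowerSeries f 0 (1 / 2)).coeff k‖ * r ^ k) ^ 2) (𝓝[<] 1)
        (𝓝 (∑ k ∈ s, ‖(cauchyPowerSeries f 0 (1 / 2)).coeff k‖ ^ 2)) := by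
      have : Continuous fun r : ℝ ↦ ∑ k ∈ s,
        (‖(cauchyPowerSeries f 0 (1 / 2)).coeff k‖ * r ^ k) ^ 2 := by fun_prop
      simpa using (this.tendsto 1).mono_left nhdsWithin_le_nhds
    refine le_of_tendsto hlim ?_
    filter_upwards [Ioo_mem_nhdsLT (zero_lt_one' ℝ)] with r hr
    simpa [heq hr.1 hr.2] using sum_sq_coeff_mul_pow_le hf hh hfh hr.1 hr.2 s

/-- A holomorphic function on the unit disk with values in the strip `|Im w| < π / 2`. -/
def logMap (z : ℂ) : ℂ := 4 - log (1 - z)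

/-- A holomorphic self-map of the unit disk that approaches the unit circle only at `1`, and so
slowly that its powers have very small norm in `H²`. -/
def slowMap (z : ℂ) : ℂ := exp (-exp (-(log (logMap z)) / 2))

theorem one_sub_re_pos {z : ℂ} (hz : z ∈ Metric.ball (0 : ℂ) 1) : 0 < (1 - z).re := by
  have := (Complex.re_le_norm z).trans_lt (mem_ball_zero_iff.1 hz)
  simpa using this

theorem three_le_logMap_re {z : ℂ} (hz : z ∈ Metric.ball (0 : ℂ) 1) : 3 ≤ (logMap z).re := by
  have h1 : ‖1 - z‖ ≤ 2 := by
    have := norm_sub_le 1 z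
    have := mem_ball_zero_iff.1 hz
    rw [norm_one] at *
    linarith
  have h2 : 0 < ‖1 - z‖ := (one_sub_re_pos hz).trans_le (Complex.re_le_norm _)
  have := Real.log_le_sub_one_of_pos h2
  simp only [logMap, sub_re, log_re]
  norm_num
  linarith

theorem abs_logMap_im_lt {z : ℂ} (hz : z ∈ Metric.ball (0 : ℂ) 1) :
    |(logMap z).im| < Real.pi / 2 := by
  simpa [logMap, log_im] using Complex.abs_arg_lt_pi_div_two_iff.2 (.inl (one_sub_re_pos hz))

theorem half_le_cos_half {x : ℝ} (hx : |x| < Real.pi / 2) : 1 / 2 ≤ Real.cos (x / 2) := by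
  have h1 := Real.one_sub_sq_div_two_le_cos (x := x / 2)
  have h2 : |x| < 2 := hx.trans (by linarith [Real.pi_lt_four])
  have h3 : x ^ 2 < 2 ^ 2 := sq_lt_sq' (by linarith [neg_abs_le x]) ((le_abs_self x).trans_lt h2)
  linarith

theorem differentiableOn_logMap : DifferentiableOn ℂ logMap (Metric.ball 0 1) := by
  intro z hz
  have : 1 - z ∈ slitPlane := .inl (one_sub_re_pos hz)
  unfold logMap
  exact ((differentiableAt_const _).sub
    (((differentiableAt_const _).sub differentiableAt_id).clog this)).differentiableWithinAt

theorem differentiableOn_slowMap : DifferentiableOn ℂ slowMap (Metric.ball 0 1) := by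
  have h : DifferentiableOn ℂ (fun z ↦ log (logMap z)) (Metric.ball 0 1) :=
    differentiableOn_logMap.clog fun z hz ↦ .inl (by linarith [three_le_logMap_re hz])
  exact ((h.neg.div_const 2).cexp.neg).cexp

theorem norm_slowMap_le {z : ℂ} (hz : z ∈ Metric.ball (0 : ℂ) 1) :
    ‖slowMap z‖ ≤ Real.exp (-(1 / 2 * (2 * (logMap z).re) ^ (-(1 / 2) : ℝ))) := by
  have h3 := three_le_logMap_re hz
  have him := abs_logMap_im_lt hz
  have h0 : 0 < ‖logMap z‖ := by linarith [Complex.re_le_norm (logMap z)]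
  have hnorm : ‖logMap z‖ ≤ 2 * (logMap z).re := by
    have := Complex.norm_le_abs_re_add_abs_im (logMap z)
    rw [abs_of_pos (by linarith : 0 < (logMap z).re)] at this
    linarith [Real.pi_lt_four]
  have harg : |(logMap z).arg| < Real.pi / 2 :=
    Complex.abs_arg_lt_pi_div_two_iff.2 (.inl (by linarith))
  have hcos := half_le_cos_half harg
  rw [slowMap, norm_exp, Real.exp_le_exp, neg_re, neg_le_neg_iff, exp_re]
  have hre : (-log (logMap z) / 2).re = Real.log ‖logMap z‖ * (-(1 / 2)) := by
    simp [log_re]; ring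
  have him : (-log (logMap z) / 2).im = -((logMap z).arg / 2) := by
    simp [log_im]; ring
  rw [hre, him, Real.cos_neg, ← Real.rpow_def_of_pos h0, mul_comm]
  exact mul_le_mul (Real.rpow_le_rpow_of_nonpos h0 hnorm (by norm_num)) hcos (by norm_num)
    (by positivity)

theorem norm_slowMap_lt_one {z : ℂ} (hz : z ∈ Metric.ball (0 : ℂ) 1) : ‖slowMap z‖ < 1 := by
  refine (norm_slowMap_le hz).trans_lt (Real.exp_lt_one_iff.2 ?_)
  have := three_le_logMap_re hz
  have : 0 < (2 * (logMap z).re) ^ (-(1 / 2) : ℝ) := by positivity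
  linarith

theorem exists_lt_norm_slowMap {ρ : ℝ} (hρ : ρ < 1) :
    ∃ z ∈ Metric.ball (0 : ℂ) 1, ρ < ‖slowMap z‖ := by
  have h1 : Tendsto (fun x : ℝ ↦ 4 - Real.log (1 - x)) (𝓝[<] 1) atTop := by
    refine tendsto_atTop_add_const_left _ _ (tendsto_neg_atBot_atTop.comp ?_)
    refine Real.tendsto_log_nhdsGT_zero.comp ?_
    refine tendsto_nhdsWithin_iff.2 ⟨?_, ?_⟩
    · have : Continuous fun x : ℝ ↦ 1 - x := by fun_prop
      simpa using (this.tendsto 1).mono_left nhdsWithin_le_nhds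
    · filter_upwards [self_mem_nhdsWithin] with x hx
      simpa using hx
  have h2 : Tendsto (fun x : ℝ ↦ Real.exp (-Real.exp (-(Real.log (4 - Real.log (1 - x))) / 2)))
      (𝓝[<] 1) (𝓝 1) := by
    have h3 : Tendsto (fun y : ℝ ↦ -Real.log y / 2) atTop atBot :=
      (tendsto_neg_atTop_atBot.comp Real.tendsto_log_atTop).atBot_div_const (by norm_num)
    have h4 := (Real.tendsto_exp_atBot.comp (h3.comp h1)).neg.rexp
    simpa using h4
  obtain ⟨x, hx, hx0, hx1⟩ := ((h2.eventually (lt_mem_nhds hρ)).and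
    (Ioo_mem_nhdsLT (zero_lt_one' ℝ))).exists
  have hmem : (x : ℂ) ∈ Metric.ball (0 : ℂ) 1 := by simpa [abs_of_pos hx0] using hx1
  refine ⟨x, hmem, ?_⟩
  have hL : logMap x = ((4 - Real.log (1 - x) : ℝ) : ℂ) := by
    rw [logMap, ofReal_sub, Complex.ofReal_log (by linarith)]
    push_cast; rfl
  have h3 := three_le_logMap_re hmem
  rw [hL, ofReal_re] at h3
  have : slowMap x =
      ((Real.exp (-Real.exp (-(Real.log (4 - Real.log (1 - x))) / 2)) : ℝ) : ℂ) := by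
    rw [slowMap, hL, ← Complex.ofReal_log (by linarith)]
    push_cast; rfl
  rw [this, norm_real, Real.norm_of_nonneg (Real.exp_pos _).le]
  exact hx

/-- Bound for the squared `H²` norm of the `m`-th power of `slowMap`. -/
def slowBound (m : ℕ) : ℝ := Real.exp (-(m : ℝ) ^ (2 / 3 : ℝ) / 2) * (1 + 2 * Real.exp 2)

theorem norm_slowMap_pow_sq_le (m : ℕ) {z : ℂ} (hz : z ∈ Metric.ball (0 : ℂ) 1) :
    ‖slowMap z ^ m‖ ^ 2 ≤
      ((Real.exp (-(m : ℝ) ^ (2 / 3 : ℝ) / 2) : ℝ) * (1 + 2 * exp (logMap z / 2))).re := by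
  set s : ℝ := (m : ℝ) ^ (2 / 3 : ℝ) with hs
  set X := (logMap z).re with hX
  have h3 : 3 ≤ X := three_le_logMap_re hz
  have hs0 : 0 ≤ s := by positivity
  have hexp : Real.exp (X / 2) ≤ 2 * (exp (logMap z / 2)).re := by
    rw [exp_re]
    have h1 : (logMap z / 2).re = X / 2 := by simp [hX]
    have h2 : (logMap z / 2).im = (logMap z).im / 2 := by simp
    rw [h1, h2]
    nlinarith [half_le_cos_half (abs_logMap_im_lt hz), Real.exp_pos (X / 2)]
  have hrhs : (((Real.exp (-s / 2) : ℝ) : ℂ) * (1 + 2 * exp (logMap z / 2))).re =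
      Real.exp (-s / 2) * (1 + 2 * (exp (logMap z / 2)).re) := by
    rw [re_ofReal_mul]; simp
  rw [hrhs]
  have hle : ‖slowMap z ^ m‖ ^ 2 ≤ Real.exp (-(m * (2 * X) ^ (-(1 / 2) : ℝ))) := by
    rw [norm_pow, ← pow_mul, mul_comm m 2]
    refine (pow_le_pow_left₀ (norm_nonneg _) (norm_slowMap_le hz) _).trans_eq ?_
    rw [← Real.exp_nat_mul]
    congr 1
    push_cast
    ring
  rcases le_total X s with hXs | hsX
  · have hm0 : 0 < s := by linarith
    have : s / 2 ≤ m * (2 * X) ^ (-(1 / 2) : ℝ) := by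
      have hm : (m : ℝ) = s ^ (3 / 2 : ℝ) := by
        rw [hs, ← Real.rpow_mul (by positivity)]; norm_num
      have h1 : (4 * s) ^ (-(1 / 2) : ℝ) ≤ (2 * X) ^ (-(1 / 2) : ℝ) :=
        Real.rpow_le_rpow_of_nonpos (by linarith) (by linarith) (by norm_num)
      have h2 : (4 * s) ^ (-(1 / 2) : ℝ) = 1 / 2 * s ^ (-(1 / 2) : ℝ) := by
        rw [Real.mul_rpow (by norm_num) hs0, show (4 : ℝ) = 2 ^ (2 : ℝ) by norm_num,
          ← Real.rpow_mul (by norm_num)]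
        norm_num [Real.rpow_neg_one]
      calc s / 2 = s ^ (3 / 2 : ℝ) * (1 / 2 * s ^ (-(1 / 2) : ℝ)) := by
            rw [mul_left_comm, ← Real.rpow_add hm0]; norm_num; ring
        _ ≤ m * (2 * X) ^ (-(1 / 2) : ℝ) := by rw [← h2, hm]; gcongr
    calc _ ≤ Real.exp (-s / 2) := hle.trans (Real.exp_le_exp.2 (by linarith))
      _ ≤ _ := by
        nlinarith [Real.exp_pos (-s / 2), Real.exp_pos (X / 2)]
  · have h1 : 1 ≤ Real.exp (-s / 2) * Real.exp (X / 2) := by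
      rw [← Real.exp_add]; exact Real.one_le_exp (by linarith)
    have h2 : Real.exp (-(m * (2 * X) ^ (-(1 / 2) : ℝ))) ≤ 1 :=
      Real.exp_le_one_iff.2 (by simp; positivity)
    nlinarith [Real.exp_pos (-s / 2), Real.exp_pos (X / 2)]

section WeightedComposition

variable {ι : Type*} {d : ι → ℂ} {p : ι → ι} {B : ℝ}

theorem sum_norm_sq_le_norm_sq (a : lp (fun _ : ι ↦ ℂ) 2) (s : Finset ι) :
    ∑ i ∈ s, ‖a i‖ ^ 2 ≤ ‖a‖ ^ 2 := by
  simpa using lp.sum_rpow_le_norm_rpow (p := 2) (by norm_num) a s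

theorem sum_norm_sq_mul_comp_le
    (hB : ∀ β, ∀ s : Finset ι, (∀ α ∈ s, p α = β) → ∑ α ∈ s, ‖d α‖ ^ 2 ≤ B)
    (a : lp (fun _ : ι ↦ ℂ) 2) (s : Finset ι) :
    ∑ α ∈ s, ‖d α * a (p α)‖ ^ 2 ≤ B * ‖a‖ ^ 2 := by
  classical
  have hB0 : 0 ≤ B ∨ IsEmpty ι := by
    rcases isEmpty_or_nonempty ι with h | ⟨⟨β⟩⟩
    · exact .inr h
    · exact .inl (by simpa using hB β ∅ (by simp))
  rcases hB0 with hB0 | hι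
  · calc ∑ α ∈ s, ‖d α * a (p α)‖ ^ 2
        = ∑ β ∈ s.image p, ∑ α ∈ s with p α = β, ‖d α * a (p α)‖ ^ 2 :=
          (Finset.sum_fiberwise_of_maps_to (fun α hα ↦ Finset.mem_image_of_mem p hα) _).symm
      _ ≤ ∑ β ∈ s.image p, B * ‖a β‖ ^ 2 := by
          refine Finset.sum_le_sum fun β _ ↦ ?_
          calc ∑ α ∈ s with p α = β, ‖d α * a (p α)‖ ^ 2
              = (∑ α ∈ s with p α = β, ‖d α‖ ^ 2) * ‖a β‖ ^ 2 := by
                rw [Finset.sum_mul]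
                refine Finset.sum_congr rfl fun α hα ↦ ?_
                rw [(Finset.mem_filter.1 hα).2, norm_mul, mul_pow]
            _ ≤ B * ‖a β‖ ^ 2 := by
                gcongr
                exact hB β _ fun α hα ↦ (Finset.mem_filter.1 hα).2
      _ ≤ B * ‖a‖ ^ 2 := by
          rw [← Finset.mul_sum]
          gcongr
          exact sum_norm_sq_le_norm_sq a _
  · have ha : a = 0 := by ext i; exact hι.elim i
    have hs : s = ∅ := Finset.eq_empty_of_isEmpty s
    simp [ha, hs]

/-- An operator on `ℓ²` of the form `a ↦ (d α * a (p α))_α` is bounded as soon as the sums of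
`‖d α‖ ^ 2` over the fibers of `p` are. -/
theorem exists_weighted_comp
    (hB : ∀ β, ∀ s : Finset ι, (∀ α ∈ s, p α = β) → ∑ α ∈ s, ‖d α‖ ^ 2 ≤ B) :
    ∃ T : lp (fun _ : ι ↦ ℂ) 2 →L[ℂ] lp (fun _ : ι ↦ ℂ) 2, ∀ a α, T a α = d α * a (p α) := by
  have hmem (a : lp (fun _ : ι ↦ ℂ) 2) : Memℓp (fun α ↦ d α * a (p α)) 2 :=
    memℓp_gen' (C := B * ‖a‖ ^ 2) fun s ↦ by simpa using sum_norm_sq_mul_comp_le hB a s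
  let L : lp (fun _ : ι ↦ ℂ) 2 →ₗ[ℂ] lp (fun _ : ι ↦ ℂ) 2 :=
    { toFun := fun a ↦ ⟨fun α ↦ d α * a (p α), hmem a⟩
      map_add' := fun a b ↦ by ext α; exact mul_add _ _ _
      map_smul' := fun c a ↦ by ext α; exact mul_left_comm _ _ _ }
  have hL (a : lp (fun _ : ι ↦ ℂ) 2) (α : ι) : L a α = d α * a (p α) := rfl
  refine ⟨L.mkContinuous (√B) fun a ↦ ?_, fun a α ↦ rfl⟩
  refine lp.norm_le_of_forall_sum_le (p := 2) (by norm_num) (by positivity) fun s ↦ ?_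
  rcases isEmpty_or_nonempty ι with h | ⟨⟨β⟩⟩
  · simp only [Finset.eq_empty_of_isEmpty s, Finset.sum_empty]; positivity
  · have hB0 : 0 ≤ B := by simpa using hB β ∅ (by simp)
    simpa [hL, mul_pow, Real.sq_sqrt hB0] using sum_norm_sq_mul_comp_le hB a s

theorem norm_weighted_comp_le
    (hB : ∀ β, ∀ s : Finset ι, (∀ α ∈ s, p α = β) → ∑ α ∈ s, ‖d α‖ ^ 2 ≤ B)
    {T : lp (fun _ : ι ↦ ℂ) 2 →L[ℂ] lp (fun _ : ι ↦ ℂ) 2} (hT : ∀ a α, T a α = d α * a (p α)) :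
    ‖T‖ ≤ √B := by
  refine T.opNorm_le_bound (by positivity) fun a ↦ ?_
  refine lp.norm_le_of_forall_sum_le (p := 2) (by norm_num) (by positivity) fun s ↦ ?_
  rcases isEmpty_or_nonempty ι with h | ⟨⟨β⟩⟩
  · simp only [Finset.eq_empty_of_isEmpty s, Finset.sum_empty]; positivity
  · have hB0 : 0 ≤ B := by simpa using hB β ∅ (by simp)
    simpa [hT, mul_pow, Real.sq_sqrt hB0] using sum_norm_sq_mul_comp_le hB a s

theorem rank_range_weighted_comp_le {F : Finset ι} (hF : ∀ α, d α ≠ 0 → p α ∈ F)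
    {R : lp (fun _ : ι ↦ ℂ) 2 →L[ℂ] lp (fun _ : ι ↦ ℂ) 2} (hR : ∀ a α, R a α = d α * a (p α)) :
    Module.rank ℂ (LinearMap.range
      (R : lp (fun _ : ι ↦ ℂ) 2 →ₗ[ℂ] lp (fun _ : ι ↦ ℂ) 2)) ≤ F.card := by
  classical
  let e : ι → lp (fun _ : ι ↦ ℂ) 2 := fun β ↦ R (lp.single 2 β 1)
  have hle : LinearMap.range (R : lp (fun _ : ι ↦ ℂ) 2 →ₗ[ℂ] lp (fun _ : ι ↦ ℂ) 2) ≤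
      Submodule.span ℂ (F.image e : Set (lp (fun _ : ι ↦ ℂ) 2)) := by
    rintro _ ⟨a, rfl⟩
    have : R a = ∑ β ∈ F, a β • e β := by
      ext α
      rw [lp.coeFn_sum, Finset.sum_apply]
      by_cases hα : d α = 0
      · simp [e, hR, hα]
      · rw [Finset.sum_eq_single_of_mem (p α) (hF α hα)]
        · simp [e, hR, mul_comm]
        · intro β _ hβ
          simp [e, hR, Pi.single_eq_of_ne hβ.symm]
    rw [ContinuousLinearMap.coe_coe, this]
    exact Submodule.sum_mem _ fun β hβ ↦ Submodule.smul_mem _ _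
      (Submodule.subset_span (Finset.mem_coe.2 (Finset.mem_image_of_mem e hβ)))
  refine (Submodule.rank_mono hle).trans ((rank_span_finset_le _).trans ?_)
  exact_mod_cast Finset.card_image_le

end WeightedComposition

section ApproxNum

variable {E F : Type*} [NormedAddCommGroup E] [NormedAddCommGroup F]
    [NormedSpace ℂ E] [NormedSpace ℂ F]

theorem approxNum_nonneg (n : ℕ) (T : E →L[ℂ] F) : 0 ≤ approxNum n T :=
  Real.sInf_nonneg (by rintro _ ⟨R, -, rfl⟩; exact norm_nonneg _)

theorem approxNum_le {n : ℕ} {T R : E →L[ℂ] F}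
    (hR : Module.rank ℂ (LinearMap.range (R : E →ₗ[ℂ] F)) < (n : Cardinal)) :
    approxNum n T ≤ ‖T - R‖ :=
  csInf_le ⟨0, by rintro _ ⟨R, -, rfl⟩; exact norm_nonneg _⟩ ⟨R, hR, rfl⟩

theorem rank_range_zero_lt (n : ℕ) :
    Module.rank ℂ (LinearMap.range ((0 : E →L[ℂ] F) : E →ₗ[ℂ] F)) < ((n + 1 : ℕ) : Cardinal) := by
  rw [ContinuousLinearMap.toLinearMap_zero, LinearMap.range_zero, rank_bot]
  exact_mod_cast n.succ_pos

theorem approxNum_succ_le_norm (n : ℕ) (T : E →L[ℂ] F) : approxNum (n + 1) T ≤ ‖T‖ := by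
  simpa using approxNum_le (T := T) (rank_range_zero_lt n)

theorem isCompactOperator_of_rank_lt {R : E →L[ℂ] F} {n : ℕ}
    (hR : Module.rank ℂ (LinearMap.range (R : E →ₗ[ℂ] F)) < (n : Cardinal)) :
    IsCompactOperator ⇑R := by
  have hfin : FiniteDimensional ℂ (LinearMap.range (R : E →ₗ[ℂ] F)) :=
    Module.rank_lt_aleph0_iff.1 (hR.trans Cardinal.natCast_lt_aleph0)
  have := FiniteDimensional.proper ℂ (LinearMap.range (R : E →ₗ[ℂ] F))
  let R' : E →L[ℂ] LinearMap.range (R : E →ₗ[ℂ] F) :=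
    R.codRestrict _ fun x ↦ LinearMap.mem_range_self (R : E →ₗ[ℂ] F) x
  exact (isCompactOperator_of_locallyCompactSpace_dom R').clm_comp
    (LinearMap.range (R : E →ₗ[ℂ] F)).subtypeL

theorem exists_pos_le_approxNum [CompleteSpace F] {T : E →L[ℂ] F} (hT : ¬ IsCompactOperator ⇑T) :
    ∃ ε > 0, ∀ n : ℕ, ε ≤ approxNum (n + 1) T := by
  have hclosed := isClosed_setOfPred_isCompactOperator (𝕜₁ := ℂ) (𝕜₂ := ℂ) (M₁ := E) (M₂ := F)
    (σ₁₂ := RingHom.id ℂ)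
  obtain ⟨ε, hε, hball⟩ := Metric.isOpen_iff.1 hclosed.isOpen_compl T hT
  refine ⟨ε, hε, fun n ↦ le_csInf ⟨_, 0, rank_range_zero_lt n, rfl⟩ ?_⟩
  rintro _ ⟨R, hR, rfl⟩
  by_contra! hlt
  refine hball (a := R) ?_ (isCompactOperator_of_rank_lt hR)
  rwa [Metric.mem_ball, dist_comm, dist_eq_norm]

end ApproxNum

theorem tendsto_one_div_rpow_zero {x : ℝ} (hx : 0 < x) :
    Tendsto (fun n : ℕ ↦ 1 / ((n : ℝ) + 1) ^ x) atTop (𝓝 0) := by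
  simp_rw [one_div]
  exact ((tendsto_rpow_atTop hx).comp
    (tendsto_atTop_add_const_right _ 1 tendsto_natCast_atTop_atTop)).inv_tendsto_atTop

theorem tendsto_const_rpow_one {c : ℝ} (hc : 0 < c) {u : ℕ → ℝ} (hu : Tendsto u atTop (𝓝 0)) :
    Tendsto (fun n ↦ c ^ u n) atTop (𝓝 1) := by
  simpa using (tendsto_const_nhds (x := c)).rpow hu (.inl hc.ne')

theorem tendsto_rpow_one_of_bounded {a : ℕ → ℝ} {ε C x : ℝ} (hε : 0 < ε) (hx : 0 < x)
    (h₁ : ∀ n, ε ≤ a n) (h₂ : ∀ n, a n ≤ C) :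
    Tendsto (fun n : ℕ ↦ a n ^ (1 / ((n : ℝ) + 1) ^ x)) atTop (𝓝 1) := by
  have hC : 0 < C := hε.trans_le ((h₁ 0).trans (h₂ 0))
  refine tendsto_of_tendsto_of_tendsto_of_le_of_le
    (tendsto_const_rpow_one hε (tendsto_one_div_rpow_zero hx))
    (tendsto_const_rpow_one hC (tendsto_one_div_rpow_zero hx)) (fun n ↦ ?_) fun n ↦ ?_
  · exact Real.rpow_le_rpow hε.le (h₁ n) (by positivity)
  · exact Real.rpow_le_rpow (hε.le.trans (h₁ n)) (h₂ n) (by positivity)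

theorem tendsto_rpow_zero_of_le_exp {a : ℕ → ℝ} {C x : ℝ} (hC : 0 < C) (hx : 0 < x)
    (hx2 : x ≤ 1 / 2) (h₀ : ∀ n, 0 ≤ a n)
    (h : ∀ n : ℕ, a n ≤ Real.exp (-(n : ℝ) ^ (2 / 3 : ℝ) / 4) * C) :
    Tendsto (fun n : ℕ ↦ a n ^ (1 / ((n : ℝ) + 1) ^ x)) atTop (𝓝 0) := by
  have hbig : Tendsto (fun n : ℕ ↦ (n : ℝ) ^ (1 / 6 : ℝ) / 8) atTop atTop :=
    ((tendsto_rpow_atTop (by norm_num)).comp tendsto_natCast_atTop_atTop).atTop_div_const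
      (by norm_num)
  have hlim := (Real.tendsto_exp_neg_atTop_nhds_zero.comp hbig).mul
    (tendsto_const_rpow_one hC (tendsto_one_div_rpow_zero hx))
  rw [zero_mul] at hlim
  refine squeeze_zero' (.of_forall fun n ↦ Real.rpow_nonneg (h₀ n) _) ?_ hlim
  filter_upwards [eventually_ge_atTop 1] with n hn
  have hn1 : (1 : ℝ) ≤ n := by exact_mod_cast hn
  have hn0 : (0 : ℝ) < n := by linarith
  refine (Real.rpow_le_rpow (h₀ n) (h n) (by positivity)).trans ?_
  rw [Real.mul_rpow (Real.exp_pos _).le hC.le, ← Real.exp_mul]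
  refine mul_le_mul_of_nonneg_right (Real.exp_le_exp.2 ?_) (by positivity)
  have h1 : ((n : ℝ) + 1) ^ x ≤ 2 * (n : ℝ) ^ (1 / 2 : ℝ) :=
    calc ((n : ℝ) + 1) ^ x ≤ ((n : ℝ) + 1) ^ (1 / 2 : ℝ) :=
          Real.rpow_le_rpow_of_exponent_le (by linarith) hx2
      _ ≤ (4 * n) ^ (1 / 2 : ℝ) := Real.rpow_le_rpow (by positivity) (by linarith) (by norm_num)
      _ = 2 * (n : ℝ) ^ (1 / 2 : ℝ) := by
          rw [Real.mul_rpow (by norm_num) hn0.le, show (4 : ℝ) = 2 ^ (2 : ℝ) by norm_num,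
            ← Real.rpow_mul (by norm_num)]
          norm_num
  have h2 : (n : ℝ) ^ (2 / 3 : ℝ) = (n : ℝ) ^ (1 / 6 : ℝ) * (n : ℝ) ^ (1 / 2 : ℝ) := by
    rw [← Real.rpow_add hn0]; norm_num
  have h3 : 0 < ((n : ℝ) + 1) ^ x := by positivity
  have h4 : 0 < (n : ℝ) ^ (1 / 6 : ℝ) := by positivity
  rw [h2, neg_div, neg_mul, neg_le_neg_iff, mul_one_div, div_le_div_iff₀ (by norm_num) h3]
  nlinarith

theorem prod_single_zero_pow {M : ℕ} (w : ℂ) (m : ℕ) :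
    ∏ i, (Pi.single 0 w : Fin (M + 2) → ℂ) i ^ (Pi.single 0 m : Fin (M + 2) → ℕ) i = w ^ m := by
  rw [Finset.prod_eq_single 0] <;> simp +contextual

theorem H2poly.eval_single_zero {M : ℕ} (a : H2poly (M + 2)) (w : ℂ) :
    H2poly.eval a (Pi.single 0 w) = ∑' m : ℕ, a (Pi.single 0 m) * w ^ m := by
  have hsupp : Function.support (fun α : Fin (M + 2) → ℕ ↦
      a α * ∏ i, (Pi.single 0 w : Fin (M + 2) → ℂ) i ^ α i) ⊆
      Set.range fun m : ℕ ↦ (Pi.single 0 m : Fin (M + 2) → ℕ) := by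
    intro α hα
    refine ⟨α 0, ?_⟩
    ext i
    by_cases hi : i = 0
    · subst hi; simp
    · simp only [Pi.single_eq_of_ne hi]
      by_contra hne
      refine hα (mul_eq_zero_of_right _ (Finset.prod_eq_zero (Finset.mem_univ i) ?_))
      rw [Pi.single_eq_of_ne hi, zero_pow (Ne.symm hne)]
  rw [H2poly.eval, ← (Pi.single_injective (0 : Fin (M + 2))).tsum_eq hsupp]
  simp_rw [prod_single_zero_pow]

theorem single_add_single_injective {M : ℕ} : Function.Injective
    fun q : ℕ × ℕ ↦ (Pi.single 0 q.2 + Pi.single 1 q.1 : Fin (M + 2) → ℕ) := by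
  intro q q' h
  have h0 := congrFun h 0
  have h1 := congrFun h 1
  simp at h0 h1
  exact Prod.ext h1 h0

theorem prod_pow_single_add_single {M : ℕ} (z : Fin (M + 2) → ℂ) (m k : ℕ) :
    ∏ i, z i ^ (Pi.single 0 k + Pi.single 1 m : Fin (M + 2) → ℕ) i = z 0 ^ k * z 1 ^ m := by
  simp_rw [Pi.add_apply, pow_add, Finset.prod_mul_distrib]
  congr 1
  · rw [Finset.prod_eq_single 0] <;> simp +contextual
  · rw [Finset.prod_eq_single 1] <;> simp +contextual

theorem H2poly.norm_apply_le {N : ℕ} (a : H2poly N) (α : Fin N → ℕ) : ‖a α‖ ≤ ‖a‖ :=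
  lp.norm_apply_le_norm (by norm_num) a α

/-- The projection of `H²(𝔻^N)` onto functions of the first variable. -/
theorem exists_compOp_proj (M : ℕ) : ∃ T : H2poly (M + 2) →L[ℂ] H2poly (M + 2),
    IsCompOpPoly (fun z ↦ Pi.single 0 (z 0)) T ∧ ¬ IsCompactOperator ⇑T := by
  classical
  let d : (Fin (M + 2) → ℕ) → ℂ := fun α ↦ if α = Pi.single 0 (α 0) then 1 else 0
  have hd (m : ℕ) : d (Pi.single 0 m) = 1 := by simp [d]
  obtain ⟨T, hT⟩ := exists_weighted_comp (d := d) (p := id) (B := 1) fun β s hs ↦ by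
    calc ∑ α ∈ s, ‖d α‖ ^ 2 ≤ ∑ α ∈ {β}, ‖d α‖ ^ 2 :=
          Finset.sum_le_sum_of_subset_of_nonneg
            (fun α hα ↦ Finset.mem_singleton.2 (hs α hα)) fun _ _ _ ↦ by positivity
      _ ≤ 1 := by
          rw [Finset.sum_singleton]
          simp only [d]
          split_ifs <;> simp
  refine ⟨T, fun a z _ ↦ ?_, fun hcomp ↦ ?_⟩
  · have hsupp : Function.support (fun α : Fin (M + 2) → ℕ ↦ T a α * ∏ i, z i ^ α i) ⊆
        Set.range fun m : ℕ ↦ (Pi.single 0 m : Fin (M + 2) → ℕ) := by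
      intro α hα
      refine ⟨α 0, ?_⟩
      by_contra hne
      exact hα (by simp [hT, d, Ne.symm hne])
    rw [H2poly.eval_single_zero, H2poly.eval,
      ← (Pi.single_injective (0 : Fin (M + 2))).tsum_eq hsupp]
    refine tsum_congr fun m ↦ ?_
    rw [hT, hd, one_mul, id]
    congr 1
    rw [Finset.prod_eq_single 0] <;> simp +contextual
  · let e : ℕ → H2poly (M + 2) := fun m ↦ lp.single 2 (Pi.single 0 m) 1
    have he (m : ℕ) : ‖e m‖ = 1 := by simp [e, lp.norm_single]
    have hTe (m : ℕ) : T (e m) = e m := by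
      ext α
      rw [hT]
      by_cases hα : α = Pi.single 0 m
      · rw [hα, hd, one_mul, id]
      · simp [e, Pi.single_eq_of_ne hα]
    obtain ⟨K, hK, hTK⟩ := hcomp.image_closedBall_subset_compact
      (f := (T : H2poly (M + 2) →ₗ[ℂ] H2poly (M + 2))) 1
    have hmem (m : ℕ) : e m ∈ K := hTK ⟨e m, by simp [he], hTe m⟩
    obtain ⟨y, -, φ, hφ, hy⟩ := hK.tendsto_subseq hmem
    have hy0 : y = 0 := by
      ext α
      have h1 : Tendsto (fun n ↦ e (φ n) α) atTop (𝓝 (y α)) := by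
        rw [tendsto_iff_norm_sub_tendsto_zero] at hy ⊢
        exact squeeze_zero (fun _ ↦ norm_nonneg _)
          (fun n ↦ H2poly.norm_apply_le (e (φ n) - y) α) hy
      refine tendsto_nhds_unique h1 (tendsto_const_nhds.congr' ?_)
      filter_upwards [eventually_gt_atTop (α 0)] with n hn
      have : α ≠ Pi.single 0 (φ n) := by
        intro h
        have h0 := congrFun h 0
        rw [Pi.single_eq_same] at h0
        exact absurd (hφ.le_apply (x := n)) (by omega)
      simp [e, Pi.single_eq_of_ne this]
    have h1 := hy.norm
    simp [he, hy0] at h1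

theorem slowBound_antitone : Antitone slowBound := by
  intro m n hmn
  unfold slowBound
  gcongr

/-- The composition operator with symbol `z ↦ (slowMap z₀ * z₁, 0, …, 0)`. -/
theorem exists_compOp_slowMap (M : ℕ) : ∃ T : H2poly (M + 2) →L[ℂ] H2poly (M + 2),
    IsCompOpPoly (fun z ↦ Pi.single 0 (slowMap (z 0) * z 1)) T ∧
    ∀ n : ℕ, ∃ R : H2poly (M + 2) →L[ℂ] H2poly (M + 2),
      Module.rank ℂ (LinearMap.range (R : H2poly (M + 2) →ₗ[ℂ] H2poly (M + 2))) <
        ((n + 1 : ℕ) : Cardinal) ∧ ‖T - R‖ ≤ √(slowBound n) := by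
  classical
  have hc (m : ℕ) : ∃ c : ℕ → ℂ,
      (∀ z ∈ Metric.ball (0 : ℂ) 1, HasSum (fun k ↦ c k * z ^ k) (slowMap z ^ m)) ∧
      ∀ s : Finset ℕ, ∑ k ∈ s, ‖c k‖ ^ 2 ≤ slowBound m := by
    obtain ⟨c, h1, h2⟩ := exists_hasSum_and_sum_sq_le (f := fun z ↦ slowMap z ^ m)
      (differentiableOn_slowMap.pow m)
      ((((differentiableOn_logMap.div_const 2).cexp.const_mul 2).const_add 1).const_mul _)
      (fun z hz ↦ norm_slowMap_pow_sq_le m hz)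
    refine ⟨c, h1, fun s ↦ (h2 s).trans_eq ?_⟩
    have hL : (logMap 0 / 2) = ((2 : ℝ) : ℂ) := by simp [logMap]; norm_num
    rw [hL, re_ofReal_mul, ← ofReal_exp, slowBound]
    simp only [add_re, one_re, re_ofNat, im_ofNat, mul_re, ofReal_re, zero_mul, sub_zero]
  choose c hsum hsq using hc
  let p : (Fin (M + 2) → ℕ) → (Fin (M + 2) → ℕ) := fun α ↦ Pi.single 0 (α 1)
  let d : Set ℕ → (Fin (M + 2) → ℕ) → ℂ := fun A α ↦
    if α = Pi.single 0 (α 0) + Pi.single 1 (α 1) ∧ α 1 ∈ A then c (α 1) (α 0) else 0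
  have hd {A : Set ℕ} {B : ℝ} (hB0 : 0 ≤ B) (hB : ∀ m ∈ A, slowBound m ≤ B)
      (β : Fin (M + 2) → ℕ) (s : Finset (Fin (M + 2) → ℕ)) (hs : ∀ α ∈ s, p α = β) :
      ∑ α ∈ s, ‖d A α‖ ^ 2 ≤ B := by
    have h1 {α} (hα : α ∈ s) : α 1 = β 0 := by simp [← hs α hα, p]
    let P : (Fin (M + 2) → ℕ) → Prop := fun α ↦
      α = Pi.single 0 (α 0) + Pi.single 1 (α 1) ∧ α 1 ∈ A
    have hsplit : ∑ α ∈ s, ‖d A α‖ ^ 2 = ∑ α ∈ s with P α, ‖c (β 0) (α 0)‖ ^ 2 := by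
      rw [Finset.sum_filter]
      refine Finset.sum_congr rfl fun α hα ↦ ?_
      simp only [d, P]
      split_ifs
      · rw [h1 hα]
      · simp
    rw [hsplit]
    by_cases hA : β 0 ∈ A
    · refine le_trans ?_ (hB _ hA)
      have hinj : Set.InjOn (fun α : Fin (M + 2) → ℕ ↦ α 0) (s.filter P : Set _) := by
        intro α hα α' hα' h
        have hα := Finset.mem_filter.1 hα
        have hα' := Finset.mem_filter.1 hα'
        rw [hα.2.1, hα'.2.1, h1 hα.1, h1 hα'.1, show α 0 = α' 0 from h]
      rw [← Finset.sum_image (f := fun k ↦ ‖c (β 0) k‖ ^ 2) hinj]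
      exact hsq _ _
    · rw [Finset.filter_false_of_mem, Finset.sum_empty]
      · exact hB0
      · rintro α hα ⟨-, hα2⟩
        exact hA (h1 hα ▸ hα2)
  have hsb (m : ℕ) : 0 ≤ slowBound m := by unfold slowBound; positivity
  obtain ⟨T, hT⟩ := exists_weighted_comp
    (hd (A := Set.univ) (hsb 0) fun m _ ↦ slowBound_antitone (Nat.zero_le m))
  refine ⟨T, fun a z hz ↦ ?_, fun n ↦ ?_⟩
  · have hsupp : Function.support (fun α : Fin (M + 2) → ℕ ↦ T a α * ∏ i, z i ^ α i) ⊆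
        Set.range fun q : ℕ × ℕ ↦ (Pi.single 0 q.2 + Pi.single 1 q.1 : Fin (M + 2) → ℕ) := by
      intro α hα
      refine ⟨(α 1, α 0), ?_⟩
      by_contra hne
      exact hα (by simp [hT, d, Ne.symm hne])
    have hterm (q : ℕ × ℕ) : T a (Pi.single 0 q.2 + Pi.single 1 q.1) *
        ∏ i, z i ^ (Pi.single 0 q.2 + Pi.single 1 q.1 : Fin (M + 2) → ℕ) i =
        (a (Pi.single 0 q.1) * z 1 ^ q.1) * (c q.1 q.2 * z 0 ^ q.2) := by
      rw [prod_pow_single_add_single, hT]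
      simp [d, p]
      ring
    have hcb (m k : ℕ) : ‖c m k‖ ≤ √(slowBound 0) := by
      refine Real.le_sqrt_of_sq_le ((?_ : _ ≤ slowBound m).trans
        (slowBound_antitone (Nat.zero_le m)))
      simpa using hsq m {k}
    have hsummable : Summable fun q : ℕ × ℕ ↦
        (a (Pi.single 0 q.1) * z 1 ^ q.1) * (c q.1 q.2 * z 0 ^ q.2) := by
      have hgeom := ((summable_geometric_of_lt_one (norm_nonneg _) (hz 1)).mul_of_nonneg
        (summable_geometric_of_lt_one (norm_nonneg _) (hz 0)) (fun _ ↦ by positivity)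
        fun _ ↦ by positivity).mul_left (‖a‖ * √(slowBound 0))
      refine .of_norm_bounded hgeom fun q ↦ ?_
      calc ‖(a (Pi.single 0 q.1) * z 1 ^ q.1) * (c q.1 q.2 * z 0 ^ q.2)‖
          = (‖a (Pi.single 0 q.1)‖ * ‖c q.1 q.2‖) * (‖z 1‖ ^ q.1 * ‖z 0‖ ^ q.2) := by
            simp only [norm_mul, norm_pow]; ring
        _ ≤ _ := by
            gcongr
            · exact H2poly.norm_apply_le _ _
            · exact hcb _ _
    rw [H2poly.eval_single_zero, H2poly.eval, ← single_add_single_injective.tsum_eq hsupp]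
    simp_rw [hterm]
    rw [hsummable.tsum_prod]
    refine tsum_congr fun m ↦ ?_
    dsimp only
    rw [tsum_mul_left, (hsum m (z 0) (mem_ball_zero_iff.2 (hz 0))).tsum_eq, mul_pow]
    ring
  · obtain ⟨R, hR⟩ := exists_weighted_comp
      (hd (A := Set.Iio n) (hsb 0) fun m _ ↦ slowBound_antitone (Nat.zero_le m))
    refine ⟨R, ?_, ?_⟩
    · let F : Finset (Fin (M + 2) → ℕ) := (Finset.range n).image fun m ↦ Pi.single 0 m
      refine (rank_range_weighted_comp_le (F := F) (fun α hα ↦ ?_) hR).trans_lt ?_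
      · have : α 1 < n := by
          by_contra hlt
          exact hα (by simp [d, hlt])
        exact Finset.mem_image_of_mem _ (Finset.mem_range.2 this)
      · have : F.card ≤ n := Finset.card_image_le.trans_eq (Finset.card_range n)
        exact_mod_cast Nat.lt_succ_of_le this
    · refine norm_weighted_comp_le (d := d (Set.Ici n)) (p := p)
        (hd (hsb n) fun m hm ↦ slowBound_antitone hm) fun a α ↦ ?_
      have : (T - R) a α = T a α - R a α := rfl
      rw [this, hT, hR, ← sub_mul]
      congr 1
      by_cases h1 : α = Pi.single 0 (α 0) + Pi.single 1 (α 1) <;> by_cases h2 : α 1 < n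
      · simp [d, ← h1, h2]
      · simp [d, ← h1, h2, not_lt.1 h2]
      · simp [d, h1]
      · simp [d, h1]

theorem differentiableOn_single_zero {M : ℕ} {g : (Fin (M + 2) → ℂ) → ℂ}
    {s : Set (Fin (M + 2) → ℂ)} (hg : DifferentiableOn ℂ g s) :
    DifferentiableOn ℂ (fun z ↦ (Pi.single 0 (g z) : Fin (M + 2) → ℂ)) s :=
  (ContinuousLinearMap.single ℂ (fun _ : Fin (M + 2) ↦ ℂ) 0).differentiable.comp_differentiableOn hg

theorem single_zero_mem_polyDisk {M : ℕ} {w : ℂ} (hw : ‖w‖ < 1) :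
    (Pi.single 0 w : Fin (M + 2) → ℂ) ∈ polyDisk (M + 2) := by
  intro i
  by_cases hi : i = 0
  · subst hi; simpa using hw
  · simp [Pi.single_eq_of_ne hi]

theorem norm_slowMap_mul_lt_one {M : ℕ} {z : Fin (M + 2) → ℂ} (hz : z ∈ polyDisk (M + 2)) :
    ‖slowMap (z 0) * z 1‖ < 1 := by
  rw [norm_mul]
  exact mul_lt_one_of_nonneg_of_lt_one_left (norm_nonneg _)
    (norm_slowMap_lt_one (mem_ball_zero_iff.2 (hz 0))) (hz 1).le

theorem image_eq_image_slowMap (M : ℕ) :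
    (fun z : Fin (M + 2) → ℂ ↦ (Pi.single 0 (z 0) : Fin (M + 2) → ℂ)) '' polyDisk (M + 2) =
      (fun z ↦ Pi.single 0 (slowMap (z 0) * z 1)) '' polyDisk (M + 2) := by
  ext y
  constructor
  · rintro ⟨z, hz, rfl⟩
    obtain ⟨x, hx, hlt⟩ := exists_lt_norm_slowMap (hz 0)
    have hpos : 0 < ‖slowMap x‖ := (norm_nonneg _).trans_lt hlt
    refine ⟨Function.update (Pi.single 0 x) 1 (z 0 / slowMap x), fun i ↦ ?_, ?_⟩
    · by_cases hi : i = 1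
      · subst hi
        rw [Function.update_self, norm_div]
        exact (div_lt_one hpos).2 hlt
      · rw [Function.update_of_ne hi]
        exact single_zero_mem_polyDisk (mem_ball_zero_iff.1 hx) i
    · simp [mul_div_cancel₀ _ (norm_pos_iff.1 hpos)]
  · rintro ⟨z, hz, rfl⟩
    exact ⟨Pi.single 0 (slowMap (z 0) * z 1),
      single_zero_mem_polyDisk (norm_slowMap_mul_lt_one hz), by simp⟩

/-- for `N ≥ 2` there are analytic `Φ₁, Φ₂ : 𝔻^N → 𝔻^N` with the same
image such that `C_{Φ₁}` is bounded non-compact on `H²(𝔻^N)` (so `β_N(C_{Φ₁}) = 1`)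
while `C_{Φ₂}` is compact with `β_N(C_{Φ₂}) = 0`. -/
theorem stmt_15 (N : ℕ) (hN : 2 ≤ N) :
    ∃ Φ₁ Φ₂ : (Fin N → ℂ) → (Fin N → ℂ),
      Set.MapsTo Φ₁ (polyDisk N) (polyDisk N) ∧ Set.MapsTo Φ₂ (polyDisk N) (polyDisk N) ∧
      DifferentiableOn ℂ Φ₁ (polyDisk N) ∧ DifferentiableOn ℂ Φ₂ (polyDisk N) ∧
      Φ₁ '' polyDisk N = Φ₂ '' polyDisk N ∧
      (∃ T₁ : H2poly N →L[ℂ] H2poly N, IsCompOpPoly Φ₁ T₁ ∧ ¬ IsCompactOperator ⇑T₁ ∧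
        Filter.Tendsto
          (fun n : ℕ => approxNum (n + 1) T₁ ^ (1 / ((n : ℝ) + 1) ^ (1 / (N : ℝ))))
          Filter.atTop (nhds 1)) ∧
      ∃ T₂ : H2poly N →L[ℂ] H2poly N, IsCompOpPoly Φ₂ T₂ ∧ IsCompactOperator ⇑T₂ ∧
        Filter.Tendsto
          (fun n : ℕ => approxNum (n + 1) T₂ ^ (1 / ((n : ℝ) + 1) ^ (1 / (N : ℝ))))
          Filter.atTop (nhds 0) := by
  obtain ⟨M, rfl⟩ : ∃ M, N = M + 2 := ⟨N - 2, by omega⟩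
  have hx : 0 < 1 / ((M + 2 : ℕ) : ℝ) := by positivity
  have hx2 : 1 / ((M + 2 : ℕ) : ℝ) ≤ 1 / 2 := by
    gcongr
    exact_mod_cast hN
  obtain ⟨T₁, hT₁, hT₁c⟩ := exists_compOp_proj M
  obtain ⟨T₂, hT₂, hR⟩ := exists_compOp_slowMap M
  obtain ⟨ε, hε, hεle⟩ := exists_pos_le_approxNum hT₁c
  have hbound (n : ℕ) : √(slowBound n) =
      Real.exp (-(n : ℝ) ^ (2 / 3 : ℝ) / 4) * √(1 + 2 * Real.exp 2) := by
    rw [slowBound, Real.sqrt_mul (Real.exp_pos _).le, ← Real.exp_half]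
    ring_nf
  have hdiff₂ : DifferentiableOn ℂ (fun z : Fin (M + 2) → ℂ ↦ slowMap (z 0) * z 1)
      (polyDisk (M + 2)) :=
    (differentiableOn_slowMap.comp (differentiable_apply 0).differentiableOn
      fun z (hz : z ∈ polyDisk (M + 2)) ↦ mem_ball_zero_iff.2 (hz 0)).mul
      (differentiable_apply 1).differentiableOn
  refine ⟨fun z ↦ Pi.single 0 (z 0), fun z ↦ Pi.single 0 (slowMap (z 0) * z 1),
    fun z (hz : z ∈ polyDisk (M + 2)) ↦ single_zero_mem_polyDisk (hz 0),
    fun z hz ↦ single_zero_mem_polyDisk (norm_slowMap_mul_lt_one hz),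
    differentiableOn_single_zero (differentiable_apply 0).differentiableOn,
    differentiableOn_single_zero hdiff₂, image_eq_image_slowMap M,
    ⟨T₁, hT₁, hT₁c, tendsto_rpow_one_of_bounded hε hx hεle fun n ↦ approxNum_succ_le_norm n T₁⟩,
    T₂, hT₂, ?_, tendsto_rpow_zero_of_le_exp (C := √(1 + 2 * Real.exp 2)) (by positivity) hx hx2
      (fun n ↦ approxNum_nonneg _ _) fun n ↦ ?_⟩
  · choose R hRrank hRnorm using hR
    refine isCompactOperator_of_tendsto (l := atTop) (F := R) ?_
      (.of_forall fun n ↦ isCompactOperator_of_rank_lt (hRrank n))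
    rw [tendsto_iff_norm_sub_tendsto_zero]
    refine squeeze_zero (fun _ ↦ norm_nonneg _)
      (fun n ↦ (norm_sub_rev _ _).trans_le ((hRnorm n).trans_eq (hbound n))) ?_
    have h1 : Tendsto (fun n : ℕ ↦ (n : ℝ) ^ (2 / 3 : ℝ) / 4) atTop atTop :=
      ((tendsto_rpow_atTop (by norm_num)).comp tendsto_natCast_atTop_atTop).atTop_div_const
        (by norm_num)
    simpa [Function.comp_def, neg_div] using
      (Real.tendsto_exp_neg_atTop_nhds_zero.comp h1).mul_const √(1 + 2 * Real.exp 2)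
  · obtain ⟨R, hRrank, hRnorm⟩ := hR n
    exact (approxNum_le hRrank).trans (hRnorm.trans_eq (hbound n))

end
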